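/- arXiv:0803.3866 — 7 statements merged into one kernel-verified Lean document; each statement's English description precedes it below -/
import Mathlib

section
/- Let u(t,x) and h(t,x) be smooth real-valued functions on ℝ² with u_x(t,x) ≠ 0 for all (t,x), and suppose u satisfies the invariant evolution u_t = u_x · h. Then the function k(t,x) := S(u)(t,x) (the Schwarzian derivative of u in the x-variable) satisfies k_t = h_xxx + 2 k h_x + k_x h; that is, k evolves by the second KdV Hamiltonian operator D³ + 2kD + k_x applied to h. -/
/-- Partial derivative in the second (`x`) variable. -/
noncomputable def pdx (f : ℝ → ℝ → ℝ) : ℝ → ℝ → ℝ := fun t x => deriv (f t) x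

/-- Partial derivative in the first (`t`) variable. -/
noncomputable def pdt (f : ℝ → ℝ → ℝ) : ℝ → ℝ → ℝ := fun t x => deriv (fun s => f s x) t

/-- The Schwarzian derivative of `u(t,x)` in the `x`-variable:
`S(u) = u_xxx/u_x − (3/2)(u_xx/u_x)²`. -/
noncomputable def Schw2 (u : ℝ → ℝ → ℝ) : ℝ → ℝ → ℝ := fun t x =>
  pdx (pdx (pdx u)) t x / pdx u t x - (3/2) * (pdx (pdx u) t x / pdx u t x)^2

open Function in
theorem hasDerivAt_pdx {f : ℝ → ℝ → ℝ} (hf : Differentiable ℝ (uncurry f)) (t x : ℝ) :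
    HasDerivAt (f t) (pdx f t x) x := by
  have hc : Differentiable ℝ (f t) :=
    hf.comp ((differentiable_const t).prodMk differentiable_id)
  exact (hc x).hasDerivAt

open Function in
theorem hasDerivAt_pdt {f : ℝ → ℝ → ℝ} (hf : Differentiable ℝ (uncurry f)) (t x : ℝ) :
    HasDerivAt (fun s => f s x) (pdt f t x) t := by
  have hc : Differentiable ℝ (fun s => f s x) :=
    hf.comp (differentiable_id.prodMk (differentiable_const x))
  exact (hc t).hasDerivAt

open Function in
theorem uncurry_pdx {f : ℝ → ℝ → ℝ} (hf : Differentiable ℝ (uncurry f)) :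
    uncurry (pdx f) = fun p => fderiv ℝ (uncurry f) p (0, 1) := by
  funext ⟨t, x⟩
  exact ((hf (t, x)).hasFDerivAt.comp_hasDerivAt x
    ((hasDerivAt_const x t).prodMk (hasDerivAt_id x))).deriv

open Function in
theorem uncurry_pdt {f : ℝ → ℝ → ℝ} (hf : Differentiable ℝ (uncurry f)) :
    uncurry (pdt f) = fun p => fderiv ℝ (uncurry f) p (1, 0) := by
  funext ⟨t, x⟩
  exact ((hf (t, x)).hasFDerivAt.comp_hasDerivAt t
    ((hasDerivAt_id t).prodMk (hasDerivAt_const t x))).deriv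

open Function in
theorem contDiff_pdx {f : ℝ → ℝ → ℝ} (hf : ContDiff ℝ (⊤ : ℕ∞) (uncurry f)) :
    ContDiff ℝ (⊤ : ℕ∞) (uncurry (pdx f)) := by
  rw [uncurry_pdx (hf.differentiable (by simp))]
  exact (hf.fderiv_right (by simp)).clm_apply contDiff_const

open Function in
theorem contDiff_pdt {f : ℝ → ℝ → ℝ} (hf : ContDiff ℝ (⊤ : ℕ∞) (uncurry f)) :
    ContDiff ℝ (⊤ : ℕ∞) (uncurry (pdt f)) := by
  rw [uncurry_pdt (hf.differentiable (by simp))]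
  exact (hf.fderiv_right (by simp)).clm_apply contDiff_const

open Function in
theorem pdt_pdx_comm {f : ℝ → ℝ → ℝ} (hf : ContDiff ℝ (⊤ : ℕ∞) (uncurry f)) :
    pdt (pdx f) = pdx (pdt f) := by
  have hd : Differentiable ℝ (uncurry f) := hf.differentiable (by simp)
  have hd' : Differentiable ℝ (fderiv ℝ (uncurry f)) :=
    (hf.fderiv_right (m := (⊤ : ℕ∞)) (by simp)).differentiable (by simp)
  funext t x
  have h₁ := congrFun (uncurry_pdt ((contDiff_pdx hf).differentiable (by simp))) (t, x)
  have h₂ := congrFun (uncurry_pdx ((contDiff_pdt hf).differentiable (by simp))) (t, x)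
  rw [uncurry_pdx hd] at h₁
  rw [uncurry_pdt hd] at h₂
  have happly (v w : ℝ × ℝ) : fderiv ℝ (fun p => fderiv ℝ (uncurry f) p v) (t, x) w =
      fderiv ℝ (fderiv ℝ (uncurry f)) (t, x) w v := by
    rw [fderiv_clm_apply (hd' _) (differentiableAt_const v)]
    simp
  rw [happly] at h₁ h₂
  have hsymm : IsSymmSndFDerivAt ℝ (uncurry f) (t, x) :=
    hf.contDiffAt.isSymmSndFDerivAt (by
      rw [minSmoothness_of_isRCLikeNormedField]
      exact WithTop.coe_le_coe.2 (le_top : (2 : ℕ∞) ≤ ⊤))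
  exact (h₁.trans (hsymm _ _)).trans h₂.symm

/-- if `u_x ≠ 0` everywhere and `u_t = u_x · h`, then `k := S(u)` satisfies
`k_t = h_xxx + 2 k h_x + k_x h`, i.e. `k` evolves by the second KdV Hamiltonian operator
`D³ + 2kD + k_x` applied to `h`. -/
theorem schwarzian_evolution_second_KdV_operator
    (u h : ℝ → ℝ → ℝ)
    (hu : ContDiff ℝ (⊤ : ℕ∞) (Function.uncurry u))
    (hh : ContDiff ℝ (⊤ : ℕ∞) (Function.uncurry h))
    (hux : ∀ t x, pdx u t x ≠ 0)
    (hev : ∀ t x, pdt u t x = pdx u t x * h t x) :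
    ∀ t x, pdt (Schw2 u) t x =
      pdx (pdx (pdx h)) t x + 2 * Schw2 u t x * pdx h t x + pdx (Schw2 u) t x * h t x := by
  have hu₁ := contDiff_pdx hu
  have hu₂ := contDiff_pdx hu₁
  have hu₃ := contDiff_pdx hu₂
  have hh₁ := contDiff_pdx hh
  have hh₂ := contDiff_pdx hh₁
  have dx {f : ℝ → ℝ → ℝ} (hf : ContDiff ℝ (⊤ : ℕ∞) (Function.uncurry f)) (t x : ℝ) :=
    hasDerivAt_pdx (hf.differentiable (by simp)) t x
  have dt {f : ℝ → ℝ → ℝ} (hf : ContDiff ℝ (⊤ : ℕ∞) (Function.uncurry f)) (t x : ℝ) :=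
    hasDerivAt_pdt (hf.differentiable (by simp)) t x
  have ev₀ : pdt u = fun t x => pdx u t x * h t x := by
    funext t x
    exact hev t x
  have ev₁ : pdt (pdx u) = fun t x => pdx (pdx u) t x * h t x + pdx u t x * pdx h t x := by
    rw [pdt_pdx_comm hu, ev₀]
    funext t x
    exact ((dx hu₁ t x).mul (dx hh t x)).deriv
  have ev₂ : pdt (pdx (pdx u)) = fun t x => pdx (pdx (pdx u)) t x * h t x
      + 2 * (pdx (pdx u) t x * pdx h t x) + pdx u t x * pdx (pdx h) t x := by
    rw [pdt_pdx_comm hu₁, ev₁]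
    funext t x
    refine (((dx hu₂ t x).mul (dx hh t x)).add ((dx hu₁ t x).mul (dx hh₁ t x))).deriv.trans ?_
    ring
  have ev₃ : pdt (pdx (pdx (pdx u))) = fun t x => pdx (pdx (pdx (pdx u))) t x * h t x
      + 3 * (pdx (pdx (pdx u)) t x * pdx h t x) + 3 * (pdx (pdx u) t x * pdx (pdx h) t x)
      + pdx u t x * pdx (pdx (pdx h)) t x := by
    rw [pdt_pdx_comm hu₂, ev₂]
    funext t x
    refine ((((dx hu₃ t x).mul (dx hh t x)).add
      (((dx hu₂ t x).mul (dx hh₁ t x)).const_mul 2)).add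
      ((dx hu₁ t x).mul (dx hh₂ t x))).deriv.trans ?_
    ring
  intro t x
  have hne := hux t x
  have hkt := (((dt hu₃ t x).div (dt hu₁ t x) hne).sub
    ((((dt hu₂ t x).div (dt hu₁ t x) hne).pow 2).const_mul (3 / 2))).deriv
  have hkx := (((dx hu₃ t x).div (dx hu₁ t x) hne).sub
    ((((dx hu₂ t x).div (dx hu₁ t x) hne).pow 2).const_mul (3 / 2))).deriv
  refine Eq.trans hkt ?_
  rw [show pdx (Schw2 u) t x = _ from hkx, ev₁, ev₂, ev₃]
  simp only [Schw2, Pi.div_apply, Nat.reduceSub, pow_one, Nat.cast_ofNat]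
  field_simp
  ring
end

section
/- Let u(t,x) be a smooth real-valued function on ℝ² with u_x(t,x) ≠ 0 for all (t,x), set k := S(u), and suppose u satisfies u_t = u_x · (2 k_xx + (1/2) k²). Then k satisfies the Sawada–Kotera equation k_t = 2 k_xxxxx + 5 k k_xxx + 5 k_x k_xx + (5/2) k² k_x. -/
/-- Joint smoothness of a function of two real variables, in curried form. -/
def Smooth₂ (f : ℝ → ℝ → ℝ) : Prop := ContDiff ℝ (⊤ : ℕ∞) (Function.uncurry f)

namespace Smooth₂

variable {f g : ℝ → ℝ → ℝ}

theorem hasDerivAt_fderiv_right (hf : Smooth₂ f) (t x : ℝ) :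
    HasDerivAt (f t) (fderiv ℝ (Function.uncurry f) (t, x) (0, 1)) x := by
  have h : HasFDerivAt (Function.uncurry f) (fderiv ℝ (Function.uncurry f) (t, x)) (t, x) :=
    (hf.differentiable (by simp) (t, x)).hasFDerivAt
  exact h.comp_hasDerivAt x ((hasDerivAt_const x t).prodMk (hasDerivAt_id x))

theorem hasDerivAt_fderiv_left (hf : Smooth₂ f) (t x : ℝ) :
    HasDerivAt (fun s => f s x) (fderiv ℝ (Function.uncurry f) (t, x) (1, 0)) t := by
  have h : HasFDerivAt (Function.uncurry f) (fderiv ℝ (Function.uncurry f) (t, x)) (t, x) :=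
    (hf.differentiable (by simp) (t, x)).hasFDerivAt
  exact h.comp_hasDerivAt t ((hasDerivAt_id t).prodMk (hasDerivAt_const t x))

theorem uncurry_pdx (hf : Smooth₂ f) :
    Function.uncurry (pdx f) = fun p => fderiv ℝ (Function.uncurry f) p (0, 1) :=
  funext fun p => (hf.hasDerivAt_fderiv_right p.1 p.2).deriv

theorem uncurry_pdt (hf : Smooth₂ f) :
    Function.uncurry (pdt f) = fun p => fderiv ℝ (Function.uncurry f) p (1, 0) :=
  funext fun p => (hf.hasDerivAt_fderiv_left p.1 p.2).deriv

theorem hasDerivAt_pdx (hf : Smooth₂ f) (t x : ℝ) : HasDerivAt (f t) (pdx f t x) x :=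
  (hf.hasDerivAt_fderiv_right t x).differentiableAt.hasDerivAt

theorem hasDerivAt_pdt (hf : Smooth₂ f) (t x : ℝ) :
    HasDerivAt (fun s => f s x) (pdt f t x) t :=
  (hf.hasDerivAt_fderiv_left t x).differentiableAt.hasDerivAt

theorem contDiff_fderiv (hf : Smooth₂ f) :
    ContDiff ℝ (⊤ : ℕ∞) (fderiv ℝ (Function.uncurry f)) :=
  ContDiff.fderiv_right (n := (⊤ : ℕ∞)) hf (by simp)

theorem pdx (hf : Smooth₂ f) : Smooth₂ (pdx f) := by
  rw [Smooth₂, hf.uncurry_pdx]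
  exact hf.contDiff_fderiv.clm_apply contDiff_const

theorem pdt (hf : Smooth₂ f) : Smooth₂ (pdt f) := by
  rw [Smooth₂, hf.uncurry_pdt]
  exact hf.contDiff_fderiv.clm_apply contDiff_const

theorem pdt_pdx (hf : Smooth₂ f) : _root_.pdt (_root_.pdx f) = _root_.pdx (_root_.pdt f) := by
  funext t x
  have hd := hf.contDiff_fderiv.differentiable (by simp) (t, x)
  have hsymm : IsSymmSndFDerivAt ℝ (Function.uncurry f) (t, x) :=
    ContDiffAt.isSymmSndFDerivAt (n := (⊤ : ℕ∞)) (ContDiff.contDiffAt hf)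
      (by simpa using WithTop.coe_le_coe.2 (le_top : (2 : ℕ∞) ≤ ⊤))
  rw [(hf.pdx.hasDerivAt_pdt t x).unique (hf.pdx.hasDerivAt_fderiv_left t x),
    (hf.pdt.hasDerivAt_pdx t x).unique (hf.pdt.hasDerivAt_fderiv_right t x),
    hf.uncurry_pdx, hf.uncurry_pdt,
    (hd.hasFDerivAt.clm_apply (hasFDerivAt_const _ _)).fderiv,
    (hd.hasFDerivAt.clm_apply (hasFDerivAt_const _ _)).fderiv]
  simpa using hsymm.eq (1, 0) (0, 1)

theorem schw2 (hf : Smooth₂ f) (hfx : ∀ t x, _root_.pdx f t x ≠ 0) : Smooth₂ (Schw2 f) := by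
  have h0 (p : ℝ × ℝ) : Function.uncurry (_root_.pdx f) p ≠ 0 := hfx p.1 p.2
  exact (ContDiff.div hf.pdx.pdx.pdx hf.pdx h0).sub
    (contDiff_const.mul ((ContDiff.div hf.pdx.pdx hf.pdx h0).pow 2))

end Smooth₂

/-- The evolution of the Schwarzian under `u_t = u_x f` is `k_t = f_xxx + 2 k f_x + k_x f`. -/
theorem pdt_Schw2_of_pdt_eq {u f : ℝ → ℝ → ℝ} (hu : Smooth₂ u) (hf : Smooth₂ f)
    (hux : ∀ t x, pdx u t x ≠ 0) (hev : ∀ t x, pdt u t x = pdx u t x * f t x) (t x : ℝ) :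
    pdt (Schw2 u) t x =
      pdx (pdx (pdx f)) t x + 2 * Schw2 u t x * pdx f t x + pdx (Schw2 u) t x * f t x := by
  have hv := hu.pdx
  have hw := hv.pdx
  have hz := hw.pdx
  have hv_t (t x : ℝ) : pdt (pdx u) t x = pdx (pdx u) t x * f t x + pdx u t x * pdx f t x := by
    rw [hu.pdt_pdx, show pdt u = fun t x => pdx u t x * f t x from funext₂ hev]
    exact ((hv.hasDerivAt_pdx t x).mul (hf.hasDerivAt_pdx t x)).deriv
  have hw_t (t x : ℝ) : pdt (pdx (pdx u)) t x = pdx (pdx (pdx u)) t x * f t x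
      + 2 * (pdx (pdx u) t x * pdx f t x) + pdx u t x * pdx (pdx f) t x := by
    rw [hv.pdt_pdx, show pdt (pdx u) = _ from funext₂ hv_t]
    exact (((hw.hasDerivAt_pdx t x).mul (hf.hasDerivAt_pdx t x)).add
      ((hv.hasDerivAt_pdx t x).mul (hf.pdx.hasDerivAt_pdx t x))).deriv.trans (by ring)
  have hz_t (t x : ℝ) : pdt (pdx (pdx (pdx u))) t x = pdx (pdx (pdx (pdx u))) t x * f t x
      + 3 * (pdx (pdx (pdx u)) t x * pdx f t x) + 3 * (pdx (pdx u) t x * pdx (pdx f) t x)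
      + pdx u t x * pdx (pdx (pdx f)) t x := by
    rw [hw.pdt_pdx, show pdt (pdx (pdx u)) = _ from funext₂ hw_t]
    exact ((((hz.hasDerivAt_pdx t x).mul (hf.hasDerivAt_pdx t x)).add
      (((hw.hasDerivAt_pdx t x).mul (hf.pdx.hasDerivAt_pdx t x)).const_mul 2)).add
      ((hv.hasDerivAt_pdx t x).mul (hf.pdx.pdx.hasDerivAt_pdx t x))).deriv.trans (by ring)
  have hk_t := (((hz.hasDerivAt_pdt t x).div (hv.hasDerivAt_pdt t x) (hux t x)).sub
    ((((hw.hasDerivAt_pdt t x).div (hv.hasDerivAt_pdt t x) (hux t x)).pow 2).const_mul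
      (3 / 2))).deriv
  have hk_x := (((hz.hasDerivAt_pdx t x).div (hv.hasDerivAt_pdx t x) (hux t x)).sub
    ((((hw.hasDerivAt_pdx t x).div (hv.hasDerivAt_pdx t x) (hux t x)).pow 2).const_mul
      (3 / 2))).deriv
  have h0 := hux t x
  rw [show pdt (Schw2 u) t x = _ from hk_t, show pdx (Schw2 u) t x = _ from hk_x,
    hv_t, hw_t, hz_t, Schw2]
  simp only [Pi.div_apply, Nat.cast_ofNat, Nat.add_one_sub_one, pow_one]
  field_simp
  ring

/-- if `u_x ≠ 0` everywhere, `k := S(u)`, and `u_t = u_x · (2k_xx + (1/2)k²)`,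
then `k` solves the Sawada–Kotera equation
`k_t = 2k_xxxxx + 5 k k_xxx + 5 k_x k_xx + (5/2) k² k_x`. -/
theorem schwarzian_realization_Sawada_Kotera
    (u : ℝ → ℝ → ℝ)
    (hu : ContDiff ℝ (⊤ : ℕ∞) (Function.uncurry u))
    (hux : ∀ t x, pdx u t x ≠ 0)
    (hev : ∀ t x, pdt u t x =
      pdx u t x * (2 * pdx (pdx (Schw2 u)) t x + (1/2) * (Schw2 u t x)^2)) :
    ∀ t x, pdt (Schw2 u) t x =
      2 * pdx (pdx (pdx (pdx (pdx (Schw2 u))))) t x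
        + 5 * Schw2 u t x * pdx (pdx (pdx (Schw2 u))) t x
        + 5 * pdx (Schw2 u) t x * pdx (pdx (Schw2 u)) t x
        + (5/2) * (Schw2 u t x)^2 * pdx (Schw2 u) t x := by
  have hu' : Smooth₂ u := hu
  have hk := hu'.schw2 hux
  set k := Schw2 u with hk_def
  have h1 := hk.pdx
  have h2 := h1.pdx
  have h3 := h2.pdx
  have h4 := h3.pdx
  have hf : Smooth₂ fun t x => 2 * pdx (pdx k) t x + (1/2) * (k t x)^2 :=
    (contDiff_const.mul h2).add (contDiff_const.mul (ContDiff.pow hk 2))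
  have hf_x : pdx (fun t x => 2 * pdx (pdx k) t x + (1/2) * (k t x)^2) =
      fun t x => 2 * pdx (pdx (pdx k)) t x + k t x * pdx k t x := by
    funext t x
    exact (((h2.hasDerivAt_pdx t x).const_mul 2).add
      (((hk.hasDerivAt_pdx t x).pow 2).const_mul (1/2))).deriv.trans (by push_cast; ring)
  have hf_xx : pdx (fun t x => 2 * pdx (pdx (pdx k)) t x + k t x * pdx k t x) =
      fun t x => 2 * pdx (pdx (pdx (pdx k))) t x
        + (pdx k t x * pdx k t x + k t x * pdx (pdx k) t x) := by
    funext t x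
    exact (((h3.hasDerivAt_pdx t x).const_mul 2).add
      ((hk.hasDerivAt_pdx t x).mul (h1.hasDerivAt_pdx t x))).deriv
  have hf_xxx (t x : ℝ) : pdx (fun t x => 2 * pdx (pdx (pdx (pdx k))) t x
        + (pdx k t x * pdx k t x + k t x * pdx (pdx k) t x)) t x =
      2 * pdx (pdx (pdx (pdx (pdx k)))) t x
        + (3 * (pdx k t x * pdx (pdx k) t x) + k t x * pdx (pdx (pdx k)) t x) := by
    exact (((h4.hasDerivAt_pdx t x).const_mul 2).add
      (((h1.hasDerivAt_pdx t x).mul (h1.hasDerivAt_pdx t x)).add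
        ((hk.hasDerivAt_pdx t x).mul (h2.hasDerivAt_pdx t x)))).deriv.trans (by ring)
  intro t x
  rw [hk_def, pdt_Schw2_of_pdt_eq hu' hf hux hev, ← hk_def, hf_x, hf_xx, hf_xxx]
  ring
end

section
/- Let λ ∈ ℝ and let u : ℝ → ℝ be smooth with u'(x) > 0 for all x. Fix x₀ ∈ ℝ and let [[a,b],[c,d]] := ρ(x₀), where ρ is the product matrix ρ(x) = [[1,0],[(1/2)u''(x)/u'(x) − λ, 1]] · [[u'(x)^{-1/2}, 0],[0, u'(x)^{1/2}]] · [[1, −u(x)],[0,1]]. Then c·u(x₀) + d ≠ 0, and the function f(x) = (a·u(x) + b)/(c·u(x) + d) satisfies the normalization equations f(x₀) = 0, f'(x₀) = 1, and f''(x₀) = 2λ. (Thus ρ is a moving frame for the SL(2,ℝ) action on ℝP¹ determined by the normalization constants 0, 1, 2λ.) -/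
/-- The moving frame `ρ(x)` for the `PSL(2)` action on `ℝP¹`:
`ρ(x) = [[1,0],[(1/2)u''/u' − λ, 1]] · [[u'^{-1/2},0],[0,u'^{1/2}]] · [[1,−u],[0,1]]`. -/
noncomputable def projFrame (lam : ℝ) (u : ℝ → ℝ) (x : ℝ) : Matrix (Fin 2) (Fin 2) ℝ :=
  !![1, 0; (1/2) * iteratedDeriv 2 u x / deriv u x - lam, 1] *
  !![(Real.sqrt (deriv u x))⁻¹, 0; 0, Real.sqrt (deriv u x)] *
  !![1, -u x; 0, 1]

/-- A unimodular fractional linear transform `(a u + b) / (c u + d)` of `u` has derivative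
`u' / (c u + d) ^ 2`. -/
lemma HasDerivAt.fractionalLinear {u : ℝ → ℝ} {u' x a b c d : ℝ} (hu : HasDerivAt u u' x)
    (hdet : a * d - b * c = 1) (hx : c * u x + d ≠ 0) :
    HasDerivAt (fun y => (a * u y + b) / (c * u y + d)) (u' / (c * u x + d) ^ 2) x := by
  refine (((hu.const_mul a).add_const b).div ((hu.const_mul c).add_const d) hx).congr_deriv ?_
  congr 1
  linear_combination u' * hdet

/-- `ρ` is a moving frame for the `SL(2,ℝ)` action on `ℝP¹` determined by the
normalization constants `0`, `1`, `2λ`: with `[[a,b],[c,d]] = ρ(x₀)` one has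
`c·u(x₀)+d ≠ 0` and the fractional transform `f = (au+b)/(cu+d)` satisfies the
normalization equations `f(x₀) = 0`, `f'(x₀) = 1`, `f''(x₀) = 2λ`. -/
theorem projFrame_solves_normalization_equations
    (lam : ℝ) (u : ℝ → ℝ) (hu : ContDiff ℝ (⊤ : ℕ∞) u) (hu' : ∀ x, 0 < deriv u x)
    (x₀ : ℝ) (a b c d : ℝ)
    (ha : a = projFrame lam u x₀ 0 0) (hb : b = projFrame lam u x₀ 0 1)
    (hc : c = projFrame lam u x₀ 1 0) (hd : d = projFrame lam u x₀ 1 1)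
    (f : ℝ → ℝ) (hf : ∀ x, f x = (a * u x + b) / (c * u x + d)) :
    c * u x₀ + d ≠ 0 ∧ f x₀ = 0 ∧ deriv f x₀ = 1 ∧ iteratedDeriv 2 f x₀ = 2 * lam := by
  have hdiff : Differentiable ℝ u := hu.differentiable (by simp)
  have hdiff' : Differentiable ℝ (deriv u) := by
    simpa [iteratedDeriv_one] using hu.differentiable_iteratedDeriv 1 (by norm_cast)
  obtain ⟨s, hs, hs2⟩ : ∃ s, 0 < s ∧ Real.sqrt (deriv u x₀) = s :=
    ⟨_, Real.sqrt_pos.2 (hu' x₀), rfl⟩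
  have hs0 : s ≠ 0 := hs.ne'
  have hsq : deriv u x₀ = s ^ 2 := by rw [← hs2, Real.sq_sqrt (hu' x₀).le]
  obtain rfl : f = fun x => (a * u x + b) / (c * u x + d) := funext hf
  simp only [projFrame, hs2, Matrix.mul_apply, Fin.sum_univ_two, Matrix.of_apply,
    Matrix.cons_val', Matrix.cons_val_zero, Matrix.cons_val_one, Matrix.cons_val_fin_one,
    mul_zero, zero_mul, add_zero, zero_add, one_mul, mul_one] at ha hb hc hd
  rw [hsq] at hc hd
  have hden : c * u x₀ + d = s := by rw [hc, hd]; ring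
  have hdet : a * d - b * c = 1 := by rw [ha, hb, hc, hd]; field_simp; ring
  have hne : c * u x₀ + d ≠ 0 := hden ▸ hs0
  have hev : deriv (fun x => (a * u x + b) / (c * u x + d)) =ᶠ[nhds x₀]
      fun x => deriv u x / (c * u x + d) ^ 2 := by
    have hcont : Continuous fun x => c * u x + d :=
      (continuous_const.mul hdiff.continuous).add continuous_const
    filter_upwards [hcont.continuousAt.eventually_ne hne] with x hx
    exact ((hdiff x).hasDerivAt.fractionalLinear hdet hx).deriv
  refine ⟨hne, ?_, ?_, ?_⟩
  · simp only [ha, hb]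
    rw [div_eq_zero_iff]
    left
    ring
  · rw [hev.eq_of_nhds, hden, hsq, div_self (pow_ne_zero 2 hs0)]
  · have hderiv := (hdiff' x₀).hasDerivAt.div
      ((((hdiff x₀).hasDerivAt.const_mul c).add_const d).pow 2) (pow_ne_zero 2 hne)
    rw [iteratedDeriv_succ, iteratedDeriv_one, hev.deriv_eq]
    refine hderiv.deriv.trans ?_
    rw [iteratedDeriv_succ, iteratedDeriv_one] at hc
    simp only [Pi.pow_apply, hden, hsq]
    rw [hc]
    field_simp
    ring
end

section
/- Let λ ∈ ℝ and let u : ℝ → ℝ be smooth with u'(x) > 0 for all x. Define the 2×2 matrix-valued function ρ(x) = [[1,0],[(1/2)u''(x)/u'(x) − λ, 1]] · [[u'(x)^{-1/2}, 0],[0, u'(x)^{1/2}]] · [[1, −u(x)],[0,1]]. Then ρ satisfies the Serret–Frenet equation ρ'(x) = K(x)·ρ(x), where K(x) = [[−λ, −1],[(1/2)S(u)(x) + λ², λ]] and S(u) = u'''/u' − (3/2)(u''/u')² is the Schwarzian derivative of u (the derivative ρ' is taken entrywise). -/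
/-- The Schwarzian derivative of a function of one real variable:
`S(u) = u'''/u' − (3/2)(u''/u')²`. -/
noncomputable def Schw (u : ℝ → ℝ) : ℝ → ℝ := fun x =>
  iteratedDeriv 3 u x / deriv u x - (3/2) * (iteratedDeriv 2 u x / deriv u x)^2

theorem hasDerivAt_iteratedDeriv {u : ℝ → ℝ} (hu : ContDiff ℝ (⊤ : ℕ∞) u) (n : ℕ) (x : ℝ) :
    HasDerivAt (iteratedDeriv n u) (iteratedDeriv (n + 1) u x) x := by
  rw [iteratedDeriv_succ]
  exact (hu.differentiable_iteratedDeriv n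
    (by exact_mod_cast WithTop.coe_lt_top n) x).hasDerivAt

theorem projFrame_eq (lam : ℝ) (u : ℝ → ℝ) (x : ℝ) :
    projFrame lam u x =
      !![(√(deriv u x))⁻¹, -(u x * (√(deriv u x))⁻¹);
        (1 / 2 * iteratedDeriv 2 u x / deriv u x - lam) * (√(deriv u x))⁻¹,
        √(deriv u x) -
          u x * ((1 / 2 * iteratedDeriv 2 u x / deriv u x - lam) * (√(deriv u x))⁻¹)] := by
  ext i j
  fin_cases i <;> fin_cases j <;> simp [projFrame, Matrix.mul_apply, Fin.sum_univ_two] <;> ring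

/-- the moving frame `ρ` satisfies the Serret–Frenet equation
`ρ'(x) = K(x)·ρ(x)` (entrywise derivative) with
`K = [[−λ,−1],[(1/2)S(u)+λ², λ]]`. -/
theorem projFrame_SerretFrenet
    (lam : ℝ) (u : ℝ → ℝ) (hu : ContDiff ℝ (⊤ : ℕ∞) u) (hu' : ∀ x, 0 < deriv u x) :
    ∀ (x : ℝ) (i j : Fin 2),
      deriv (fun y => projFrame lam u y i j) x =
        (!![-lam, -1; (1/2) * Schw u x + lam^2, lam] * projFrame lam u x) i j := by
  intro x i j
  have hv := hu' x
  have d0 : HasDerivAt u (deriv u x) x := by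
    simpa [iteratedDeriv_one] using hasDerivAt_iteratedDeriv hu 0 x
  have d1 : HasDerivAt (deriv u) (iteratedDeriv 2 u x) x := by
    simpa [iteratedDeriv_one] using hasDerivAt_iteratedDeriv hu 1 x
  have d2 : HasDerivAt (iteratedDeriv 2 u) (iteratedDeriv 3 u x) x :=
    hasDerivAt_iteratedDeriv hu 2 x
  have ds := d1.sqrt hv.ne'
  have hs : 0 < √(deriv u x) := Real.sqrt_pos.2 hv
  have dr := ds.fun_inv hs.ne'
  have da := ((d2.const_mul (1 / 2)).fun_div d1 hv.ne').sub_const lam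
  have dar := da.fun_mul dr
  have hsq : deriv u x = √(deriv u x) ^ 2 := (Real.sq_sqrt hv.le).symm
  simp only [projFrame_eq]
  generalize hS : √(deriv u x) = s at *
  fin_cases i <;> fin_cases j <;>
    simp only [Fin.zero_eta, Fin.mk_one, Matrix.mul_apply, Fin.sum_univ_two, Matrix.of_apply,
      Matrix.cons_val_zero, Matrix.cons_val_one, Schw]
  · rw [dr.deriv, hsq]
    field_simp
    ring
  · rw [(d0.fun_mul dr).fun_neg.deriv, hS, hsq]
    field_simp
    ring
  · rw [dar.deriv, hsq]
    field_simp
    ring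
  · rw [(ds.fun_sub (d0.fun_mul dar)).deriv, hS, hsq]
    field_simp
    ring
end

section
/- Let λ ∈ ℝ and let u(t,x), h(t,x) be smooth real-valued functions on ℝ² with u_x(t,x) > 0 for all (t,x), and suppose u_t = u_x · h. Define ρ(t,x) = [[1,0],[(1/2)u_xx/u_x − λ, 1]] · [[u_x^{-1/2}, 0],[0, u_x^{1/2}]] · [[1, −u],[0,1]] (all entries evaluated at (t,x)). Then the t-evolution induced on the moving frame ρ is ∂_t ρ = N · ρ, where N = [[−(1/2)h_x − λh, −h],[(1/2)h_xx + λh_x + λ²h + (1/2)S(u)h, (1/2)h_x + λh]] and S(u) = u_xxx/u_x − (3/2)(u_xx/u_x)² is the Schwarzian derivative of u in the x-variable. -/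
/-- The moving frame `ρ(t,x)` along the flow `u(t,·)`:
`ρ = [[1,0],[(1/2)u_xx/u_x − λ, 1]] · [[u_x^{-1/2},0],[0,u_x^{1/2}]] · [[1,−u],[0,1]]`. -/
noncomputable def projFrame2 (lam : ℝ) (u : ℝ → ℝ → ℝ) (t x : ℝ) :
    Matrix (Fin 2) (Fin 2) ℝ :=
  !![1, 0; (1/2) * pdx (pdx u) t x / pdx u t x - lam, 1] *
  !![(Real.sqrt (pdx u t x))⁻¹, 0; 0, Real.sqrt (pdx u t x)] *
  !![1, -(u t x); 0, 1]

/-- Smoothness of a function of two real variables, jointly in both. -/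
def JointlySmooth (f : ℝ → ℝ → ℝ) : Prop := ContDiff ℝ (⊤ : ℕ∞) (Function.uncurry f)

namespace JointlySmooth

variable {f : ℝ → ℝ → ℝ}

theorem hasDerivAt_snd (hf : JointlySmooth f) (t x : ℝ) :
    HasDerivAt (f t) (fderiv ℝ (Function.uncurry f) (t, x) (0, 1)) x := by
  have hF := (ContDiff.differentiable hf (by simp) (t, x)).hasFDerivAt
  exact hF.comp_hasDerivAt x ((hasDerivAt_const x t).prodMk (hasDerivAt_id x))

theorem hasDerivAt_fst (hf : JointlySmooth f) (t x : ℝ) :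
    HasDerivAt (fun s => f s x) (fderiv ℝ (Function.uncurry f) (t, x) (1, 0)) t := by
  have hF := (ContDiff.differentiable hf (by simp) (t, x)).hasFDerivAt
  exact hF.comp_hasDerivAt t ((hasDerivAt_id t).prodMk (hasDerivAt_const t x))

theorem pdx_eq_fderiv (hf : JointlySmooth f) (t x : ℝ) :
    pdx f t x = fderiv ℝ (Function.uncurry f) (t, x) (0, 1) :=
  (hf.hasDerivAt_snd t x).deriv

theorem pdt_eq_fderiv (hf : JointlySmooth f) (t x : ℝ) :
    pdt f t x = fderiv ℝ (Function.uncurry f) (t, x) (1, 0) :=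
  (hf.hasDerivAt_fst t x).deriv

theorem hasDerivAt_pdx (hf : JointlySmooth f) (t x : ℝ) : HasDerivAt (f t) (pdx f t x) x :=
  (hf.hasDerivAt_snd t x).differentiableAt.hasDerivAt

theorem hasDerivAt_pdt (hf : JointlySmooth f) (t x : ℝ) :
    HasDerivAt (fun s => f s x) (pdt f t x) t :=
  (hf.hasDerivAt_fst t x).differentiableAt.hasDerivAt

theorem contDiff_fderiv (hf : JointlySmooth f) :
    ContDiff ℝ (⊤ : ℕ∞) (fderiv ℝ (Function.uncurry f)) :=
  ContDiff.fderiv_right hf (by simp)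

theorem uncurry_pdx (hf : JointlySmooth f) :
    Function.uncurry (pdx f) = fun p => fderiv ℝ (Function.uncurry f) p (0, 1) :=
  funext fun p => hf.pdx_eq_fderiv p.1 p.2

theorem smooth_pdx (hf : JointlySmooth f) : JointlySmooth (pdx f) := by
  rw [JointlySmooth, hf.uncurry_pdx]
  exact hf.contDiff_fderiv.clm_apply contDiff_const

theorem uncurry_pdt (hf : JointlySmooth f) :
    Function.uncurry (pdt f) = fun p => fderiv ℝ (Function.uncurry f) p (1, 0) :=
  funext fun p => hf.pdt_eq_fderiv p.1 p.2

theorem smooth_pdt (hf : JointlySmooth f) : JointlySmooth (pdt f) := by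
  rw [JointlySmooth, hf.uncurry_pdt]
  exact hf.contDiff_fderiv.clm_apply contDiff_const

theorem pdt_pdx (hf : JointlySmooth f) (t x : ℝ) :
    pdt (pdx f) t x = pdx (pdt f) t x := by
  have hsymm : IsSymmSndFDerivAt ℝ (Function.uncurry f) (t, x) :=
    (ContDiff.contDiffAt hf).isSymmSndFDerivAt
      (by simpa using WithTop.coe_le_coe.2 (le_top : (2 : ℕ∞) ≤ ⊤))
  have hD := hf.contDiff_fderiv.differentiable (by simp) (t, x)
  have key (v w : ℝ × ℝ) : fderiv ℝ (fun p => fderiv ℝ (Function.uncurry f) p v) (t, x) w =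
      fderiv ℝ (fderiv ℝ (Function.uncurry f)) (t, x) w v := by
    rw [fderiv_clm_apply hD (differentiableAt_const v)]
    simp
  rw [hf.smooth_pdx.pdt_eq_fderiv, hf.smooth_pdt.pdx_eq_fderiv, hf.uncurry_pdx, hf.uncurry_pdt,
    key, key]
  exact hsymm.eq _ _

end JointlySmooth

/-- if `u_x > 0` and `u_t = u_x · h`, the `t`-evolution induced on the
moving frame `ρ` is `∂_t ρ = N·ρ` with
`N = [[−(1/2)h_x − λh, −h],[(1/2)h_xx + λh_x + λ²h + (1/2)S(u)h, (1/2)h_x + λh]]`. -/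
theorem frame_time_evolution
    (lam : ℝ) (u h : ℝ → ℝ → ℝ)
    (hu : ContDiff ℝ (⊤ : ℕ∞) (Function.uncurry u))
    (hh : ContDiff ℝ (⊤ : ℕ∞) (Function.uncurry h))
    (hux : ∀ t x, 0 < pdx u t x)
    (hev : ∀ t x, pdt u t x = pdx u t x * h t x) :
    ∀ (t x : ℝ) (i j : Fin 2),
      deriv (fun s => projFrame2 lam u s x i j) t =
        (!![-(1/2) * pdx h t x - lam * h t x, -(h t x);
            (1/2) * pdx (pdx h) t x + lam * pdx h t x + lam^2 * h t x
              + (1/2) * Schw2 u t x * h t x,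
            (1/2) * pdx h t x + lam * h t x] * projFrame2 lam u t x) i j := by
  intro t x i j
  have su : JointlySmooth u := hu
  have sh : JointlySmooth h := hh
  have mixed₁ (t x : ℝ) :
      pdt (pdx u) t x = pdx (pdx u) t x * h t x + pdx u t x * pdx h t x := by
    rw [su.pdt_pdx, show pdt u = fun t x => pdx u t x * h t x from
      funext fun t => funext fun x => hev t x]
    exact ((su.smooth_pdx.hasDerivAt_pdx t x).mul (sh.hasDerivAt_pdx t x)).deriv
  have mixed₂ : pdt (pdx (pdx u)) t x = pdx (pdx (pdx u)) t x * h t x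
      + 2 * pdx (pdx u) t x * pdx h t x + pdx u t x * pdx (pdx h) t x := by
    rw [su.smooth_pdx.pdt_pdx, show pdt (pdx u) = fun t x =>
      pdx (pdx u) t x * h t x + pdx u t x * pdx h t x from
      funext fun t => funext fun x => mixed₁ t x]
    refine (((su.smooth_pdx.smooth_pdx.hasDerivAt_pdx t x).mul (sh.hasDerivAt_pdx t x)).add
      ((su.smooth_pdx.hasDerivAt_pdx t x).mul (sh.smooth_pdx.hasDerivAt_pdx t x))).deriv.trans ?_
    ring
  have du := su.hasDerivAt_pdt t x
  have dp := su.smooth_pdx.hasDerivAt_pdt t x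
  have dq := su.smooth_pdx.smooth_pdx.hasDerivAt_pdt t x
  rw [hev] at du
  rw [mixed₁] at dp
  rw [mixed₂] at dq
  have hp := hux t x
  have hr : Real.sqrt (pdx u t x) ≠ 0 := (Real.sqrt_pos.2 hp).ne'
  have hsq : pdx u t x = Real.sqrt (pdx u t x) ^ 2 := (Real.sq_sqrt hp.le).symm
  have dr := dp.sqrt hp.ne'
  have di := dr.inv hr
  have da := ((dq.const_mul (1/2)).div dp hp.ne').sub_const lam
  fin_cases i <;> fin_cases j <;>
    simp only [projFrame2, Matrix.mul_apply, Fin.sum_univ_two, Matrix.of_apply, Matrix.cons_val',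
      Matrix.cons_val_zero, Matrix.cons_val_one, Matrix.cons_val_fin_one, Fin.zero_eta, Fin.mk_one,
      Fin.isValue, mul_zero, zero_mul, mul_one, one_mul, add_zero, zero_add, Schw2]
  on_goal 1 => refine di.deriv.trans ?_
  on_goal 2 => refine (di.mul du.neg).deriv.trans ?_
  on_goal 3 => refine (da.mul di).deriv.trans ?_
  on_goal 4 => refine (((da.mul di).mul du.neg).add dr).deriv.trans ?_
  all_goals
    try simp only [Pi.mul_apply, Pi.neg_apply, Pi.inv_apply, Pi.div_apply]
    generalize Real.sqrt (pdx u t x) = r at *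
    rw [hsq]
    field_simp
    ring
end

section
/- Let k, v, a, b : ℝ → ℝ be smooth, and set K = [[0, 1],[k, 0]] and M = [[a, v],[b, −a]]. Suppose that the (1,1), (1,2) and (2,2) entries of M' + (KM − MK) vanish identically (i.e. M' + [K,M] lies in the annihilator of the parabolic subalgebra, the strictly lower triangular matrices). Then necessarily a = (1/2)v' and b = k v − (1/2)v'', and in that case the remaining (2,1) entry equals −(1/2)v''' + 2 k v' + k' v, i.e. the second KdV Hamiltonian operator −(1/2)D³ + kD + Dk applied to v. -/
/-- for `K = [[0,1],[k,0]]` and `M = [[a,v],[b,−a]]`, if the (1,1), (1,2)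
and (2,2) entries of `M' + [K,M]` vanish identically (i.e. `M' + [K,M]` lies in the
annihilator of the parabolic subalgebra), then `a = (1/2)v'` and `b = kv − (1/2)v''`,
and the remaining (2,1) entry equals `−(1/2)v''' + 2kv' + k'v`, the second KdV
Hamiltonian operator `−(1/2)D³ + kD + Dk` applied to `v`. -/
theorem parabolic_reduction_gives_second_KdV_operator
    (k v a b : ℝ → ℝ)
    (hk : ContDiff ℝ (⊤ : ℕ∞) k) (hv : ContDiff ℝ (⊤ : ℕ∞) v)
    (ha : ContDiff ℝ (⊤ : ℕ∞) a) (hb : ContDiff ℝ (⊤ : ℕ∞) b)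
    (K M : ℝ → Matrix (Fin 2) (Fin 2) ℝ)
    (hK : ∀ x, K x = !![0, 1; k x, 0])
    (hM : ∀ x, M x = !![a x, v x; b x, -a x])
    (E : ℝ → Matrix (Fin 2) (Fin 2) ℝ)
    (hE : ∀ x, E x = (Matrix.of fun i j => deriv (fun y => M y i j) x) +
      (K x * M x - M x * K x))
    (h00 : ∀ x, E x 0 0 = 0) (h01 : ∀ x, E x 0 1 = 0) (h11 : ∀ x, E x 1 1 = 0) :
    (∀ x, a x = (1/2) * deriv v x) ∧
    (∀ x, b x = k x * v x - (1/2) * iteratedDeriv 2 v x) ∧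
    (∀ x, E x 1 0 = -(1/2) * iteratedDeriv 3 v x + 2 * k x * deriv v x
      + deriv k x * v x) := by
  have e00 : ∀ x, deriv a x + b x - k x * v x = 0 := fun x => by
    have h := h00 x
    rw [hE] at h
    simp [hM, hK] at h
    linarith
  have e01 : ∀ x, deriv v x - 2 * a x = 0 := fun x => by
    have h := h01 x
    rw [hE] at h
    simp [hM, hK] at h
    linarith
  have e10 : ∀ x, E x 1 0 = deriv b x + 2 * k x * a x := fun x => by
    rw [hE]
    simp [hM, hK]
    ring
  have dk : Differentiable ℝ k := hk.differentiable (by simp)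
  have dv : Differentiable ℝ v := hv.differentiable (by simp)
  have da : Differentiable ℝ a := ha.differentiable (by simp)
  have db : Differentiable ℝ b := hb.differentiable (by simp)
  have v1 : deriv v = fun x => 2 * a x := funext fun x => by linarith [e01 x]
  have v2 : iteratedDeriv 2 v = fun x => 2 * (k x * v x - b x) := funext fun x => by
    rw [iteratedDeriv_succ, iteratedDeriv_one, v1, deriv_const_mul _ (da x)]
    linarith [e00 x]
  have v3 : ∀ x, iteratedDeriv 3 v x =
      2 * (deriv k x * v x + k x * deriv v x - deriv b x) := fun x => by
    rw [iteratedDeriv_succ, v2]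
    exact ((((dk x).hasDerivAt.fun_mul (dv x).hasDerivAt).fun_sub
      (db x).hasDerivAt).const_mul 2).deriv
  refine ⟨fun x => by linarith [e01 x], fun x => by rw [v2]; ring, fun x => ?_⟩
  rw [e10, v3, v1]
  ring
end

section
/- Let κ, τ, h₁, h₂, α : ℝ → ℝ be smooth with κ(x) ≠ 0 for all x. Set K = [[0, −κ, 0],[κ, 0, −τ],[0, τ, 0]] (the so(3) block of the Euclidean Serret–Frenet matrix for a curve with curvature κ and torsion τ) and M = [[0, h₁, α],[−h₁, 0, h₂],[−α, −h₂, 0]]. Suppose the (2,3) entry of M' + (KM − MK) vanishes identically. Then α = −(1/κ)h₂', and in that case the (2,1) entry of M' + (KM − MK) equals −h₁' − (τ/κ)h₂' and its (3,1) entry equals ((1/κ)h₂')' + κ h₂ − τ h₁. (These are the two components of the reduced Hamiltonian operator R from the Euclidean/NLS reduction applied to (h₁, h₂).) -/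
/-- Euclidean/NLS reduction. With `κ ≠ 0`,
`K = [[0,−κ,0],[κ,0,−τ],[0,τ,0]]` (the `so(3)` block of the Euclidean Serret–Frenet
matrix) and `M = [[0,h₁,α],[−h₁,0,h₂],[−α,−h₂,0]]`, if the (2,3) entry of
`M' + [K,M]` vanishes identically then `α = −(1/κ)h₂'`, and then the (2,1) entry of
`M' + [K,M]` equals `−h₁' − (τ/κ)h₂'` and its (3,1) entry equals
`((1/κ)h₂')' + κh₂ − τh₁`, the components of the reduced Hamiltonian operator. -/
theorem euclidean_reduction_operator
    (kap tau h₁ h₂ alpha : ℝ → ℝ)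
    (hkap : ContDiff ℝ (⊤ : ℕ∞) kap) (htau : ContDiff ℝ (⊤ : ℕ∞) tau)
    (hh₁ : ContDiff ℝ (⊤ : ℕ∞) h₁) (hh₂ : ContDiff ℝ (⊤ : ℕ∞) h₂)
    (halpha : ContDiff ℝ (⊤ : ℕ∞) alpha)
    (hk0 : ∀ x, kap x ≠ 0)
    (K M : ℝ → Matrix (Fin 3) (Fin 3) ℝ)
    (hK : ∀ x, K x = !![0, -kap x, 0; kap x, 0, -tau x; 0, tau x, 0])
    (hM : ∀ x, M x = !![0, h₁ x, alpha x; -h₁ x, 0, h₂ x; -alpha x, -h₂ x, 0])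
    (E : ℝ → Matrix (Fin 3) (Fin 3) ℝ)
    (hE : ∀ x, E x = (Matrix.of fun i j => deriv (fun y => M y i j) x) +
      (K x * M x - M x * K x))
    (h23 : ∀ x, E x 1 2 = 0) :
    (∀ x, alpha x = -(1 / kap x) * deriv h₂ x) ∧
    (∀ x, E x 1 0 = -deriv h₁ x - (tau x / kap x) * deriv h₂ x) ∧
    (∀ x, E x 2 0 = deriv (fun y => (1 / kap y) * deriv h₂ y) x
      + kap x * h₂ x - tau x * h₁ x) := by
  have h_alpha : ∀ x, alpha x = -(1 / kap x) * deriv h₂ x := by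
    intro x
    have h := h23 x
    simp [hE, hK, hM] at h
    have hk := hk0 x
    field_simp
    linarith
  refine ⟨h_alpha, fun x => ?_, fun x => ?_⟩
  · simp [hE, hK, hM, h_alpha x]
    ring
  · have h_fun : (fun y => (1 / kap y) * deriv h₂ y) = fun y => -alpha y := by
      funext y
      rw [h_alpha y]
      ring
    rw [h_fun]
    simp [hE, hK, hM]
    ring
end
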